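/- arXiv:0807.4133 — 3 statements merged into one kernel-verified Lean document; each statement's English description precedes it below -/
import Mathlib

section
/- Let I ⊆ ℝ be a nonempty open interval, n ∈ ℕ, n ≥ 1, and let f : I → ℝ be n-convex. Then f is (n−1)-times differentiable on I, the (n−1)-st derivative g = f^{(n−1)} has a finite left derivative and a finite right derivative at every point of I (so the one-sided n-th derivatives f^{(n)}_− and f^{(n)}_+ exist on I), and g is differentiable at almost every point of I (so f^{(n)} exists almost everywhere on I with respect to Lebesgue measure). -/
/-- `f` is `n`-convex on `s ⊆ ℝ`: every divided difference
`[x₁,…,x_{n+2}; f] = ∑ i, f(xᵢ)/∏_{j≠i}(xᵢ-xⱼ)` of `f` at `n+2` pairwise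
distinct points of `s` is nonnegative. -/
def NConvexOn (n : ℕ) (s : Set ℝ) (f : ℝ → ℝ) : Prop :=
  ∀ x : Fin (n + 2) → ℝ, Function.Injective x → (∀ i, x i ∈ s) →
    0 ≤ ∑ i, f (x i) / ∏ j ∈ Finset.univ.erase i, (x i - x j)

open Filter Topology

theorem Fin.prod_univ_erase_eq_prod_ite {M : Type*} [CommMonoid M] {m : ℕ} (g : Fin m → M)
    (i : Fin m) : ∏ j ∈ Finset.univ.erase i, g j = ∏ j, if j = i then 1 else g j := by
  rw [← Finset.mul_prod_erase _ _ (Finset.mem_univ i), if_pos rfl, one_mul]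
  exact Finset.prod_congr rfl fun j hj => (if_neg (Finset.ne_of_mem_erase hj)).symm

theorem Fin.prod_univ_erase_zero {M : Type*} [CommMonoid M] {m : ℕ} (g : Fin (m + 1) → M) :
    ∏ j ∈ Finset.univ.erase 0, g j = ∏ j : Fin m, g j.succ := by
  simp [Fin.prod_univ_erase_eq_prod_ite, Fin.prod_univ_succ]

theorem Fin.prod_univ_erase_succ {M : Type*} [CommMonoid M] {m : ℕ} (g : Fin (m + 1) → M)
    (k : Fin m) :
    ∏ j ∈ Finset.univ.erase k.succ, g j = g 0 * ∏ j ∈ Finset.univ.erase k, g j.succ := by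
  simp [Fin.prod_univ_erase_eq_prod_ite, Fin.prod_univ_succ, (Fin.succ_ne_zero k).symm]

/-- The divided difference of `f` at the points `x i`. -/
noncomputable def dividedDifference {m : ℕ} (x : Fin m → ℝ) (f : ℝ → ℝ) : ℝ :=
  ∑ i, f (x i) / ∏ j ∈ Finset.univ.erase i, (x i - x j)

theorem prod_erase_sub_ne_zero {m : ℕ} {x : Fin m → ℝ} (hx : Function.Injective x) (i : Fin m) :
    ∏ j ∈ Finset.univ.erase i, (x i - x j) ≠ 0 :=
  Finset.prod_ne_zero_iff.2 fun _ hj =>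
    sub_ne_zero.2 (hx.ne (Finset.ne_of_mem_erase hj).symm)

theorem dividedDifference_cons {m : ℕ} (a : ℝ) (x : Fin m → ℝ) (f : ℝ → ℝ) :
    dividedDifference (Fin.cons a x : Fin (m + 1) → ℝ) f =
      f a / ∏ j, (a - x j) +
        ∑ i, f (x i) / ((x i - a) * ∏ j ∈ Finset.univ.erase i, (x i - x j)) := by
  simp [dividedDifference, Fin.sum_univ_succ, Fin.prod_univ_erase_zero,
    Fin.prod_univ_erase_succ]

theorem dividedDifference_const {m : ℕ} {x : Fin (m + 2) → ℝ} (hx : Function.Injective x)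
    (c : ℝ) : dividedDifference x (fun _ => c) = 0 := by
  have h := Lagrange.coeff_eq_sum (s := Finset.univ) hx.injOn (P := Polynomial.C c)
    (Polynomial.degree_C_le.trans_lt (by simp; norm_cast; omega))
  simp only [Polynomial.eval_C] at h
  rw [dividedDifference, ← h]
  exact Polynomial.coeff_C_of_ne_zero (by simp)

/-- Divided differences of the slope function at a node `a` are divided differences of `f`. -/
theorem dividedDifference_slope {m : ℕ} {a : ℝ} {x : Fin (m + 1) → ℝ} (f : ℝ → ℝ)
    (hx : Function.Injective (Fin.cons a x : Fin (m + 2) → ℝ)) :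
    dividedDifference x (slope f a) =
      dividedDifference (Fin.cons a x : Fin (m + 2) → ℝ) f := by
  have h := dividedDifference_const hx (f a)
  rw [dividedDifference_cons] at h ⊢
  rw [← sub_zero (f a / _ + _), ← h, add_sub_add_left_eq_sub, ← Finset.sum_sub_distrib]
  refine Finset.sum_congr rfl fun i _ => ?_
  rw [slope_def_field, div_div, sub_div]

theorem dividedDifference_update_sub {m : ℕ} {y : Fin m → ℝ} (f : ℝ → ℝ)
    (hy : Function.Injective y) (i : Fin m) {u : ℝ} (hu : ∀ j, u ≠ y j) :
    dividedDifference (Function.update y i u) f - dividedDifference y f =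
      (u - y i) * dividedDifference (Fin.cons u y : Fin (m + 1) → ℝ) f := by
  have hui : u - y i ≠ 0 := sub_ne_zero.2 (hu i)
  have hiu : y i - u ≠ 0 := sub_ne_zero.2 (hu i).symm
  rw [dividedDifference_cons, dividedDifference, dividedDifference,
    ← Finset.add_sum_erase _ _ (Finset.mem_univ i),
    ← Finset.add_sum_erase Finset.univ (fun k => f (y k) / _) (Finset.mem_univ i),
    ← Finset.add_sum_erase Finset.univ (fun k => f (y k) / (_ * _)) (Finset.mem_univ i),
    mul_add, mul_add, Finset.mul_sum]
  have hu' : ∏ j ∈ Finset.univ.erase i, (Function.update y i u i - Function.update y i u j)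
      = ∏ j ∈ Finset.univ.erase i, (u - y j) :=
    Finset.prod_congr rfl fun j hj => by
      rw [Function.update_self, Function.update_of_ne (Finset.ne_of_mem_erase hj)]
  have h₁ : f (Function.update y i u i) /
        ∏ j ∈ Finset.univ.erase i, (Function.update y i u i - Function.update y i u j)
      = (u - y i) * (f u / ∏ j, (u - y j)) := by
    rw [hu', Function.update_self, ← Finset.mul_prod_erase _ _ (Finset.mem_univ i)]
    field_simp
  have h₂ : (u - y i) * (f (y i) / ((y i - u) * ∏ j ∈ Finset.univ.erase i, (y i - y j)))
      = -(f (y i) / ∏ j ∈ Finset.univ.erase i, (y i - y j)) := by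
    have := prod_erase_sub_ne_zero hy i
    field_simp
    ring
  have h₃ : ∀ k ∈ Finset.univ.erase i,
      f (Function.update y i u k) /
          ∏ j ∈ Finset.univ.erase k, (Function.update y i u k - Function.update y i u j)
        = (u - y i) * (f (y k) / ((y k - u) * ∏ j ∈ Finset.univ.erase k, (y k - y j)))
          + f (y k) / ∏ j ∈ Finset.univ.erase k, (y k - y j) := by
    intro k hk
    have hki := Finset.ne_of_mem_erase hk
    have hmem : i ∈ Finset.univ.erase k := Finset.mem_erase.2 ⟨hki.symm, Finset.mem_univ i⟩
    have hrest : ∏ j ∈ (Finset.univ.erase k).erase i, (y k - Function.update y i u j)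
        = ∏ j ∈ (Finset.univ.erase k).erase i, (y k - y j) :=
      Finset.prod_congr rfl fun j hj => by
        rw [Function.update_of_ne (Finset.ne_of_mem_erase hj)]
    have hne := prod_erase_sub_ne_zero hy k
    rw [← Finset.mul_prod_erase _ _ hmem] at hne
    have hku : y k - u ≠ 0 := sub_ne_zero.2 (hu k).symm
    rw [Function.update_of_ne hki, ← Finset.mul_prod_erase _ _ hmem, hrest,
      Function.update_self, ← Finset.mul_prod_erase _ (fun j => y k - y j) hmem]
    have hy₁ := left_ne_zero_of_mul hne
    have hy₂ := right_ne_zero_of_mul hne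
    field_simp
    ring
  rw [h₁, h₂, Finset.sum_congr rfl h₃, Finset.sum_add_distrib]
  ring

namespace NConvexOn

variable {n : ℕ} {s : Set ℝ} {f : ℝ → ℝ}

theorem slope (hf : NConvexOn (n + 1) s f) {a : ℝ} (ha : a ∈ s) :
    NConvexOn n (s \ {a}) (slope f a) := by
  intro x hx hxs
  have hinj : Function.Injective (Fin.cons a x : Fin (n + 3) → ℝ) :=
    Fin.cons_injective_iff.2 ⟨fun ⟨i, hi⟩ => (hxs i).2 hi, hx⟩
  have h := hf _ hinj (Fin.cases ha fun i => (hxs i).1)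
  exact h.trans_eq (dividedDifference_slope f hinj).symm

theorem monotoneOn (hf : NConvexOn 0 s f) : MonotoneOn f s := by
  intro x hx y hy hxy
  rcases hxy.eq_or_lt with rfl | hlt
  · rfl
  have h := hf ![x, y] (by intro i j; fin_cases i <;> fin_cases j <;> simp [hlt.ne, hlt.ne'])
    (by intro i; fin_cases i <;> simp [hx, hy])
  change 0 ≤ dividedDifference (Fin.cons x ![y] : Fin 2 → ℝ) f at h
  rw [dividedDifference_cons] at h
  simp at h
  have h' : f x / (x - y) + f y / (y - x) = (f y - f x) / (y - x) := by
    rw [← neg_sub y x, div_neg, sub_div]; ring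
  rw [h', le_div_iff₀ (sub_pos.2 hlt)] at h
  linarith

theorem slope_le_slope (hf : NConvexOn 1 s f) {p x y : ℝ} (hp : p ∈ s) (hx : x ∈ s) (hy : y ∈ s)
    (hxp : x ≠ p) (hyp : y ≠ p) (hxy : x ≤ y) : _root_.slope f p x ≤ _root_.slope f p y :=
  (hf.slope hp).monotoneOn ⟨hx, hxp⟩ ⟨hy, hyp⟩ hxy

theorem convexOn (hf : NConvexOn 1 s f) (hs : Convex ℝ s) : ConvexOn ℝ s f := by
  refine convexOn_of_slope_mono_adjacent hs fun {x y z} hx hz hxy hyz => ?_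
  have hy : y ∈ s := hs.ordConnected.out hx hz ⟨hxy.le, hyz.le⟩
  have h := hf.slope_le_slope hy hx hz hxy.ne hyz.ne' (hxy.trans hyz).le
  rwa [slope_comm, slope_def_field, slope_def_field] at h

theorem exists_lipschitzOnWith (hf : NConvexOn 1 s f) {a : ℝ} (hs : s ∈ 𝓝[≠] a) :
    ∃ K, ∃ t ∈ 𝓝[≠] a, LipschitzOnWith K f t := by
  obtain ⟨⟨l, u⟩, ⟨hl, hu⟩, hlu⟩ :=
    (nhds_basis_Ioo a).mem_iff.1 (mem_nhdsWithin_iff_eventually.1 hs)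
  have hmem : ∀ x, l < x → x < u → x ≠ a → x ∈ s := fun x h₁ h₂ h₃ => hlu ⟨h₁, h₂⟩ h₃
  obtain ⟨b, hlb, hba⟩ := exists_between hl
  obtain ⟨c, hbc, hca⟩ := exists_between hba
  obtain ⟨e, hae, heu⟩ := exists_between hu
  obtain ⟨d, had, hde⟩ := exists_between hae
  simp only at hl hu hlb heu
  have hb := hmem b hlb (by linarith) hba.ne
  have hc := hmem c (by linarith) (by linarith) hca.ne
  have he := hmem e (by linarith) heu hae.ne'
  have hd := hmem d (by linarith) (by linarith) had.ne'
  refine ⟨Real.toNNReal (max |_root_.slope f b c| |_root_.slope f d e|), Set.Ioo c d ∩ {a}ᶜ,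
    inter_mem (mem_nhdsWithin_of_mem_nhds (Ioo_mem_nhds hca had)) self_mem_nhdsWithin, ?_⟩
  have key : ∀ x ∈ Set.Ioo c d ∩ {a}ᶜ, ∀ y ∈ Set.Ioo c d ∩ {a}ᶜ, x < y →
      |f x - f y| ≤ max |_root_.slope f b c| |_root_.slope f d e| * |x - y| := by
    rintro x ⟨⟨hx₁, hx₂⟩, hxa⟩ y ⟨⟨hy₁, hy₂⟩, hya⟩ hxy
    have hx := hmem x (by linarith) (by linarith) hxa
    have hy := hmem y (by linarith) (by linarith) hya
    have h₁ := hf.slope_le_slope hc hb hx hbc.ne hx₁.ne' (by linarith)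
    have h₂ := hf.slope_le_slope hx hc hy hx₁.ne hxy.ne' (by linarith)
    have h₃ := hf.slope_le_slope hy hx hd hxy.ne hy₂.ne' (by linarith)
    have h₄ := hf.slope_le_slope hd hy he hy₂.ne hde.ne' (by linarith)
    rw [slope_comm f c b, slope_comm f c x] at h₁
    rw [slope_comm f y x, slope_comm f y d] at h₃
    have h₅ : |_root_.slope f x y| ≤ max |_root_.slope f b c| |_root_.slope f d e| :=
      abs_le_max_abs_abs (h₁.trans h₂) (h₃.trans h₄)
    have h₆ : f x - f y = _root_.slope f x y * (x - y) := by
      rw [slope_def_field]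
      have := sub_ne_zero.2 hxy.ne'
      field_simp
      ring
    rw [h₆, abs_mul]
    gcongr
  refine LipschitzOnWith.of_dist_le_mul fun x hx y hy => ?_
  rw [Real.coe_toNNReal _ (le_max_of_le_left (abs_nonneg _)), Real.dist_eq, Real.dist_eq]
  rcases lt_trichotomy x y with h | rfl | h
  · exact key x hx y hy h
  · simp
  · rw [abs_sub_comm (f x), abs_sub_comm x]
    exact key y hy x hx h

/-- An `n`-convex function with `n ≥ 1` on a punctured neighborhood of `a` has a finite limit
at `a`. -/
theorem exists_tendsto_nhdsNE (hf : NConvexOn (n + 1) s f) {a : ℝ} (hs : s ∈ 𝓝[≠] a) :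
    ∃ l, Tendsto f (𝓝[≠] a) (𝓝 l) := by
  induction n generalizing s f with
  | zero =>
    obtain ⟨K, t, ht, hK⟩ := hf.exists_lipschitzOnWith hs
    obtain ⟨g, hg, hfg⟩ := hK.extend_real
    refine ⟨g a, (hg.continuous.tendsto a |>.mono_left nhdsWithin_le_nhds).congr' ?_⟩
    filter_upwards [ht] with x hx using (hfg hx).symm
  | succ n ih =>
    obtain ⟨b, hbs, hba⟩ :=
      nonempty_of_mem (inter_mem hs self_mem_nhdsWithin : s ∩ {a}ᶜ ∈ 𝓝[≠] a)
    have hb : {b}ᶜ ∈ 𝓝[≠] a :=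
      mem_nhdsWithin_of_mem_nhds (isOpen_compl_singleton.mem_nhds (Ne.symm hba))
    obtain ⟨l, hl⟩ := ih (hf.slope hbs) (inter_mem hs hb)
    have hid : Tendsto (fun x : ℝ => x - b) (𝓝[≠] a) (𝓝 (a - b)) :=
      ((continuous_id.sub continuous_const).tendsto a).mono_left nhdsWithin_le_nhds
    refine ⟨(a - b) * l + f b, ((hid.mul hl).add_const (f b)).congr' ?_⟩
    filter_upwards with x
    simpa [smul_eq_mul] using! sub_smul_slope_vadd f b x

theorem differentiableAt (hf : NConvexOn (n + 2) s f) {a : ℝ} (hs : s ∈ 𝓝 a) :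
    DifferentiableAt ℝ f a := by
  obtain ⟨l, hl⟩ := (hf.slope (mem_of_mem_nhds hs)).exists_tendsto_nhdsNE (a := a)
    (inter_mem (mem_nhdsWithin_of_mem_nhds hs) self_mem_nhdsWithin)
  exact (hasDerivAt_iff_tendsto_slope.2 hl).differentiableAt

/-- Divided differences of order `n` of an `n`-convex function increase when all nodes are
translated to the right, provided old and new nodes are distinct. -/
theorem dividedDifference_le_add (hf : NConvexOn n s f) {y : Fin (n + 1) → ℝ}
    (hy : Function.Injective y) (hys : ∀ i, y i ∈ s) {h : ℝ} (hh : 0 < h)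
    (hyh : ∀ i, y i + h ∈ s) (hne : ∀ i j, y i + h ≠ y j) :
    dividedDifference y f ≤ dividedDifference (fun i => y i + h) f := by
  have hinj : ∀ T : Finset (Fin (n + 1)),
      Function.Injective (T.piecewise (fun i => y i + h) y) := by
    intro T i j hij
    by_cases hi : i ∈ T <;> by_cases hj : j ∈ T <;> simp [hi, hj] at hij
    · exact hy hij
    · exact absurd hij (hne i j)
    · exact absurd hij.symm (hne j i)
    · exact hy hij
  suffices H : ∀ T : Finset (Fin (n + 1)),
      dividedDifference y f ≤ dividedDifference (T.piecewise (fun i => y i + h) y) f by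
    simpa using H Finset.univ
  intro T
  induction T using Finset.induction_on with
  | empty => simp
  | insert i T hi ih =>
    refine ih.trans ?_
    have hu : ∀ j, y i + h ≠ T.piecewise (fun i => y i + h) y j := by
      intro j
      by_cases hj : j ∈ T
      · simpa [hj] using hy.ne (ne_of_mem_of_not_mem hj hi).symm
      · simpa [hj] using hne i j
    rw [Finset.piecewise_insert, ← sub_nonneg, dividedDifference_update_sub f (hinj T) i hu]
    refine mul_nonneg (by simp [hi, hh.le]) (hf _ ?_ ?_)
    · exact Fin.cons_injective_iff.2 ⟨fun ⟨j, hj⟩ => hu j hj.symm, hinj T⟩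
    · refine Fin.cases (hyh i) fun j => ?_
      by_cases hj : j ∈ T <;> simp [hj, hys, hyh]

/-- The derivative of a differentiable `(n + 1)`-convex function on an open set is
`n`-convex. -/
theorem of_hasDerivAt (hf : NConvexOn (n + 1) s f) (hs : IsOpen s) {f' : ℝ → ℝ}
    (hf' : ∀ x ∈ s, HasDerivAt f (f' x) x) : NConvexOn n s f' := by
  intro y hy hys
  have hderiv : HasDerivAt (fun h : ℝ => dividedDifference (fun i => y i + h) f)
      (dividedDifference y f') 0 := by
    simp only [dividedDifference, add_sub_add_right_eq_sub]
    refine HasDerivAt.fun_sum fun i _ => HasDerivAt.div_const ?_ _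
    have := hf' (y i) (hys i)
    exact HasDerivAt.comp_const_add (y i) 0 (by simpa using this)
  have hlim := (hasDerivAt_iff_tendsto_slope.1 hderiv).mono_left (nhdsGT_le_nhdsNE 0)
  refine ge_of_tendsto hlim ?_
  have hcont : ∀ i, Tendsto (fun h : ℝ => y i + h) (𝓝[>] 0) (𝓝 (y i)) := fun i => by
    simpa using ((continuous_const.add continuous_id).tendsto (0 : ℝ)).mono_left
      (nhdsWithin_le_nhds (s := Set.Ioi 0)) (f := fun h : ℝ => y i + h)
  have h₁ : ∀ᶠ h : ℝ in 𝓝[>] 0, ∀ i, y i + h ∈ s :=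
    eventually_all.2 fun i => (hcont i).eventually (hs.mem_nhds (hys i))
  have h₂ : ∀ᶠ h : ℝ in 𝓝[>] 0, ∀ i j, y i + h ≠ y j := by
    refine eventually_all.2 fun i => eventually_all.2 fun j => ?_
    by_cases hij : i = j
    · filter_upwards [self_mem_nhdsWithin] with h (hh : 0 < h)
      simp [hij, hh.ne']
    · exact (hcont i).eventually_ne (hy.ne hij)
  filter_upwards [h₁, h₂, self_mem_nhdsWithin] with h hh₁ hh₂ (hh : 0 < h)
  have hle := hf.dividedDifference_le_add hy hys hh hh₁ hh₂
  rw [slope_def_field]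
  simp only [add_zero, sub_zero]
  exact div_nonneg (sub_nonneg.2 hle) hh.le

theorem derivWithin (hf : NConvexOn (n + 2) s f) (hs : IsOpen s) :
    NConvexOn (n + 1) s (derivWithin f s) :=
  hf.of_hasDerivAt hs fun x hx => by
    rw [derivWithin_of_isOpen hs hx]
    exact (hf.differentiableAt (hs.mem_nhds hx)).hasDerivAt

theorem iteratedDerivWithin {k : ℕ} (hf : NConvexOn (n + 1 + k) s f) (hs : IsOpen s) :
    NConvexOn (n + 1) s (iteratedDerivWithin k f s) := by
  induction k generalizing n with
  | zero => simpa using hf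
  | succ k ih =>
    have h : NConvexOn (n + 2) s (_root_.iteratedDerivWithin k f s) :=
      ih (by convert hf using 1; omega)
    rw [iteratedDerivWithin_succ]
    exact h.derivWithin hs

end NConvexOn

theorem ConvexOn.ae_differentiableAt_of_isOpen {s : Set ℝ} {f : ℝ → ℝ} (hf : ConvexOn ℝ s f)
    (hs : IsOpen s) : ∀ᵐ x ∂MeasureTheory.volume, x ∈ s → DifferentiableAt ℝ f x := by
  rw [MeasureTheory.ae_iff]
  refine MeasureTheory.measure_null_of_locally_null _ fun x hx => ?_
  simp only [Classical.not_imp, Set.mem_ofPred_eq] at hx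
  obtain ⟨K, t, ht, hK⟩ := hf.locallyLipschitzOn hs hx.1
  rw [hs.nhdsWithin_eq hx.1] at ht
  refine ⟨{y | ¬ (y ∈ interior t → DifferentiableAt ℝ f y)}, ?_, ?_⟩
  · filter_upwards [self_mem_nhdsWithin,
      mem_nhdsWithin_of_mem_nhds (interior_mem_nhds.2 ht)] with y hy hyt
    exact fun h => hy fun _ => h hyt
  · rw [← MeasureTheory.ae_iff]
    filter_upwards [(hK.mono interior_subset).ae_differentiableWithinAt_of_mem_real] with y hy hyt
    exact (hy hyt).differentiableAt (isOpen_interior.mem_nhds hyt)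

/-- An `n`-convex function on a nonempty open interval `I` is `(n-1)`-times
differentiable on `I`; its `(n-1)`-st derivative has finite one-sided
derivatives everywhere on `I` and is differentiable almost everywhere on `I`. -/
theorem nconvex_oneSided_derivatives_and_ae_differentiable
    (I : Set ℝ) (hIo : IsOpen I) (hIne : I.Nonempty) (hIconv : Convex ℝ I)
    (n : ℕ) (hn : 1 ≤ n) (f : ℝ → ℝ) (hf : NConvexOn n I f) :
    (∀ k < n - 1, DifferentiableOn ℝ (iteratedDerivWithin k f I) I) ∧
    (∀ x ∈ I,
      (∃ L : ℝ, HasDerivWithinAt (iteratedDerivWithin (n - 1) f I) L (Set.Iio x) x) ∧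
      (∃ L : ℝ, HasDerivWithinAt (iteratedDerivWithin (n - 1) f I) L (Set.Ioi x) x)) ∧
    (∀ᵐ x ∂MeasureTheory.volume, x ∈ I →
      DifferentiableAt ℝ (iteratedDerivWithin (n - 1) f I) x) := by
  obtain ⟨m, rfl⟩ := Nat.exists_eq_add_of_le' hn
  have hconv : ConvexOn ℝ I (iteratedDerivWithin m f I) :=
    (NConvexOn.iteratedDerivWithin (n := 0) (by convert hf using 1; omega) hIo).convexOn hIconv
  rw [Nat.add_sub_cancel]
  refine ⟨fun k hk x hx => ?_, fun x hx => ?_, hconv.ae_differentiableAt_of_isOpen hIo⟩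
  · obtain ⟨d, rfl⟩ := Nat.exists_eq_add_of_lt hk
    have h : NConvexOn (d + 2) I (iteratedDerivWithin k f I) :=
      NConvexOn.iteratedDerivWithin (by convert hf using 1; omega) hIo
    exact (h.differentiableAt (hIo.mem_nhds hx)).differentiableWithinAt
  · have hx' : x ∈ interior I := by rwa [hIo.interior_eq]
    exact ⟨⟨_, hconv.hasDerivWithinAt_leftDeriv_of_mem_interior hx'⟩,
      ⟨_, hconv.hasDerivWithinAt_rightDeriv_of_mem_interior hx'⟩⟩
end

section
/- Let n ∈ ℕ, n ≥ 1, let f : [a,b] → ℝ be 2n-convex, and let x_1,…,x_n be pairwise distinct points of the open interval (a,b) and x_{n+1} = b. Then there exists a polynomial p of degree at most 2n such that p(x_i) = f(x_i) for i = 1,…,n+1 and p(x) ≥ f(x) for all x ∈ [a,b]. -/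
open Polynomial Finset Filter Topology

/-- The divided difference of a polynomial of degree less than the number of nodes minus one
vanishes. -/
theorem Polynomial.sum_eval_div_prod_sub_eq_zero {ι : Type*} [Fintype ι] [DecidableEq ι]
    {z : ι → ℝ} (hz : Function.Injective z) {p : ℝ[X]} (hp : p.natDegree + 1 < Fintype.card ι) :
    ∑ i, p.eval (z i) / ∏ j ∈ univ.erase i, (z i - z j) = 0 := by
  rw [← Lagrange.coeff_eq_sum hz.injOn]
  · exact coeff_eq_zero_of_natDegree_lt (by rw [card_univ]; omega)
  · exact degree_le_natDegree.trans_lt (by rw [card_univ]; exact_mod_cast (by omega))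

/-- In an `n`-convex function, divided differences over nodes indexed by any type with `n + 2`
elements are nonnegative. -/
theorem NConvexOn.sum_div_prod_sub_nonneg {N : ℕ} {s : Set ℝ} {f : ℝ → ℝ} (hf : NConvexOn N s f)
    {ι : Type*} [Fintype ι] [DecidableEq ι] (hι : Fintype.card ι = N + 2)
    {z : ι → ℝ} (hz : Function.Injective z) (hzs : ∀ i, z i ∈ s) :
    0 ≤ ∑ i, f (z i) / ∏ j ∈ univ.erase i, (z i - z j) := by
  let e : Fin (N + 2) ≃ ι := (Fintype.equivFinOfCardEq hι).symm
  convert hf (z ∘ e) (hz.comp e.injective) (fun i => hzs _) using 1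
  rw [← e.sum_comp]
  refine sum_congr rfl fun i _ => ?_
  congr 1
  refine (prod_nbij' e e.symm ?_ ?_ ?_ ?_ ?_).symm <;> simp [Equiv.symm_apply_eq]

/-- Sign of the interpolation error of an `N`-convex function. -/
theorem NConvexOn.sub_eval_div_prod_sub_nonneg {N : ℕ} {s : Set ℝ} {f : ℝ → ℝ}
    (hf : NConvexOn N s f) {ι : Type*} [Fintype ι] [DecidableEq ι]
    (hι : Fintype.card ι = N + 1) {z : ι → ℝ} (hz : Function.Injective z) (hzs : ∀ i, z i ∈ s)
    {p : ℝ[X]} (hp : p.natDegree ≤ N) (hpz : ∀ i, p.eval (z i) = f (z i))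
    {t : ℝ} (ht : t ∈ s) (htz : ∀ i, t ≠ z i) :
    0 ≤ (f t - p.eval t) / ∏ i, (t - z i) := by
  let w : Option ι → ℝ := fun o => o.elim t z
  have hw : Function.Injective w := by
    rintro (_ | i) (_ | j) h
    · rfl
    · exact absurd h (htz j)
    · exact absurd h.symm (htz i)
    · exact congrArg some (hz h)
  have hcard : Fintype.card (Option ι) = N + 2 := by rw [Fintype.card_option, hι]
  have h1 := hf.sum_div_prod_sub_nonneg hcard hw (by rintro (_ | i); exacts [ht, hzs i])
  have h2 := sum_eval_div_prod_sub_eq_zero hw (p := p) (by omega)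
  have he : (univ : Finset (Option ι)).erase none = univ.map Function.Embedding.some := by
    ext o; cases o <;> simp
  rw [Fintype.sum_option, he, prod_map] at h1 h2
  simp only [w, Option.elim, Function.Embedding.some_apply, hpz] at h1 h2
  rw [sub_div]
  linarith

/-- A sequence of polynomials of bounded degree that is bounded at sufficiently many nodes has a
subsequence converging along every linear functional. -/
theorem Polynomial.exists_tendsto_subseq_of_eval_mem_Icc {ι : Type*} [Fintype ι]
    {z : ι → ℝ} (hz : Function.Injective z) {q : ℕ → ℝ[X]}
    (hq : ∀ m, (q m).natDegree < Fintype.card ι) {l u : ι → ℝ}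
    (hb : ∀ m i, (q m).eval (z i) ∈ Set.Icc (l i) (u i)) :
    ∃ (p : ℝ[X]) (φ : ℕ → ℕ), StrictMono φ ∧
      ∀ L : ℝ[X] →ₗ[ℝ] ℝ, Tendsto (fun m => L (q (φ m))) atTop (𝓝 (L p)) := by
  classical
  have hK : IsCompact (Set.univ.pi fun i => Set.Icc (l i) (u i)) :=
    isCompact_univ_pi fun i => isCompact_Icc
  obtain ⟨v, -, φ, hφ, hv⟩ := hK.tendsto_subseq (x := fun m i => (q m).eval (z i))
    fun m i _ => hb m i
  refine ⟨Lagrange.interpolate univ z v, φ, hφ, fun L => ?_⟩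
  have hc : Continuous (L ∘ₗ Lagrange.interpolate univ z) :=
    LinearMap.continuous_of_finiteDimensional _
  refine ((hc.tendsto v).comp hv).congr fun m => ?_
  simp only [Function.comp_apply, LinearMap.comp_apply]
  rw [← Lagrange.eq_interpolate hz.injOn]
  exact degree_le_natDegree.trans_lt (by rw [card_univ]; exact_mod_cast hq _)

/-- For nodes `x i` paired with their shifts `x i - d`, the denominator attached to a shifted node
in the divided difference over all of them is negative. -/
theorem prod_erase_inr_sub_neg {ι : Type*} [Fintype ι] [DecidableEq ι] {x : ι → ℝ} {d : ℝ}
    (hd : 0 < d) (hx : ∀ i j, i ≠ j → d < |x i - x j|) (i : ι) :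
    ∏ j ∈ univ.erase (Sum.inr i : ι ⊕ ι),
      (Sum.elim x (fun k => x k - d) (Sum.inr i) - Sum.elim x (fun k => x k - d) j) < 0 := by
  have he : univ.erase (Sum.inr i : ι ⊕ ι) = univ.disjSum (univ.erase i) := by
    ext (j | j) <;> simp
  rw [he, prod_disjSum, ← mul_prod_erase univ _ (mem_univ i), mul_assoc, ← prod_mul_distrib]
  refine mul_neg_of_neg_of_pos (by simpa using hd) (prod_pos fun j hj => ?_)
  have h := hx i j (ne_of_mem_erase hj).symm
  simp only [Sum.elim_inl, Sum.elim_inr]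
  rcases lt_abs.1 h with h | h <;> nlinarith

/-- Bounds at shifted nodes for a polynomial that agrees with `f` at the nodes and lies above `f`
at the shifted ones. -/
theorem eval_le_of_eval_eq_of_le_eval_shift {ι : Type*} [Fintype ι] [DecidableEq ι] {x : ι → ℝ}
    {d : ℝ} (hd : 0 < d) (hx : ∀ i j, i ≠ j → d < |x i - x j|) (f : ℝ → ℝ) (i : ι) :
    ∃ M : ℝ, ∀ p : ℝ[X], p.natDegree + 1 < Fintype.card (ι ⊕ ι) →
      (∀ k, p.eval (x k) = f (x k)) → (∀ k, f (x k - d) ≤ p.eval (x k - d)) →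
      p.eval (x i - d) ≤ M := by
  set z : ι ⊕ ι → ℝ := Sum.elim x (fun k => x k - d) with hz_def
  have hxi : Function.Injective x := fun i j h => by
    by_contra hij
    have := hx i j hij
    rw [h, sub_self, abs_zero] at this
    exact hd.not_gt this
  have hz : Function.Injective z := by
    refine hxi.sumElim (fun i j h => hxi (sub_left_injective h)) fun i j h => ?_
    have hij : i ≠ j := by
      rintro rfl
      linarith
    have := hx i j hij
    rw [h, sub_sub_cancel_left, abs_neg, abs_of_pos hd] at this
    exact this.false
  let W : ι ⊕ ι → ℝ := fun i => ∏ j ∈ univ.erase i, (z i - z j)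
  have hW : ∀ k, W (Sum.inr k) < 0 := prod_erase_inr_sub_neg hd hx
  refine ⟨f (x i - d) + (∑ k, f (z k) / W k) * -W (Sum.inr i), fun p hp hpx hpt => ?_⟩
  have h0 : ∑ k, p.eval (z k) / W k = 0 := sum_eval_div_prod_sub_eq_zero hz hp
  have hsum : ∑ k, (p.eval (x k - d) - f (x k - d)) / -W (Sum.inr k) = ∑ k, f (z k) / W k := by
    rw [← sub_zero (∑ k, f (z k) / W k), ← h0, ← sum_sub_distrib, Fintype.sum_sum_type]
    simp only [hz_def, Sum.elim_inl, Sum.elim_inr, hpx, sub_self, sum_const_zero, zero_add]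
    refine sum_congr rfl fun k _ => ?_
    rw [← sub_div, div_neg, ← neg_div, neg_sub]
  have hle := single_le_sum (f := fun k => (p.eval (x k - d) - f (x k - d)) / -W (Sum.inr k))
    (fun k _ => div_nonneg (sub_nonneg.2 (hpt k)) (neg_nonneg.2 (hW k).le)) (mem_univ i)
  rw [hsum, div_le_iff₀ (neg_pos.2 (hW i))] at hle
  linarith

/-- Support theorem (right Radau type): a `2n`-convex function on `[a,b]` admits,
for `n` pairwise distinct interior nodes and the node `x_n = b`, a polynomial of
degree at most `2n` interpolating it at these `n+1` points and supporting it
from above on `[a,b]`. -/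
theorem nconvex_support_above_right_endpoint_nodes
    (n : ℕ) (hn : 1 ≤ n) (a b : ℝ) (hab : a < b) (f : ℝ → ℝ)
    (hf : NConvexOn (2 * n) (Set.Icc a b) f)
    (x : Fin (n + 1) → ℝ) (hxinj : Function.Injective x)
    (hxl : x (Fin.last n) = b)
    (hx : ∀ i, i ≠ Fin.last n → x i ∈ Set.Ioo a b) :
    ∃ p : Polynomial ℝ, p.natDegree ≤ 2 * n ∧
      (∀ i, p.eval (x i) = f (x i)) ∧
      (∀ t ∈ Set.Icc a b, f t ≤ p.eval t) := by
  obtain ⟨g, hg, hgx, hga⟩ : ∃ g : ℝ, 0 < g ∧ (∀ i j, i ≠ j → g < |x i - x j|) ∧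
      ∀ i, g < x i - a := by
    have hpos : ∀ᶠ g : ℝ in 𝓝[>] 0, 0 < g := self_mem_nhdsWithin
    have hlt : ∀ c : ℝ, 0 < c → ∀ᶠ g : ℝ in 𝓝[>] 0, g < c := fun c hc =>
      nhdsWithin_le_nhds (Iio_mem_nhds hc)
    refine (hpos.and (Filter.Eventually.and ?_ ?_)).exists
    · refine eventually_all.2 fun i => eventually_all.2 fun j => eventually_imp_distrib_left.2 ?_
      exact fun hij => hlt _ (abs_pos.2 (sub_ne_zero.2 (hxinj.ne hij)))
    · refine eventually_all.2 fun i => hlt _ (sub_pos.2 ?_)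
      by_cases hi : i = Fin.last n
      · rw [hi, hxl]; exact hab
      · exact (hx i hi).1
  have hxmem : ∀ i, x i ∈ Set.Icc a b := fun i => by
    by_cases hi : i = Fin.last n
    · rw [hi, hxl]; exact ⟨hab.le, le_rfl⟩
    · exact Set.Ioo_subset_Icc_self (hx i hi)
  have hxb : ∀ i : Fin n, x i.castSucc + g < b := fun i => by
    have h1 := hgx (Fin.last n) i.castSucc (Fin.castSucc_lt_last i).ne'
    have h2 := (hx i.castSucc (Fin.castSucc_lt_last i).ne).2
    rw [hxl, abs_of_pos (by linarith)] at h1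
    linarith
  -- Interpolants at the nodes together with slightly shifted copies of the interior ones.
  have key : ∀ h : ℝ, 0 < h → h < g → ∃ p : ℝ[X], p.natDegree ≤ 2 * n ∧
      (∀ i, p.eval (x i) = f (x i)) ∧ ∀ t ∈ Set.Icc a b,
        (∀ i, 0 < (t - x i) * (t - x i - h)) → f t ≤ p.eval t := by
    intro h hh hhg
    let z : Fin (n + 1) ⊕ Fin n → ℝ := Sum.elim x fun i => x i.castSucc + h
    have hz : Function.Injective z := by
      refine hxinj.sumElim (fun i j hij => ?_) fun i j hij => ?_
      · exact Fin.castSucc_injective _ (hxinj (add_left_injective h hij))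
      · have hne : i ≠ j.castSucc := by
          rintro rfl
          linarith
        have := hgx i j.castSucc hne
        rw [hij, add_sub_cancel_left, abs_of_pos hh] at this
        linarith
    have hcard : Fintype.card (Fin (n + 1) ⊕ Fin n) = 2 * n + 1 := by
      simp only [Fintype.card_sum, Fintype.card_fin]; omega
    have hzs : ∀ i, z i ∈ Set.Icc a b := by
      rintro (i | i)
      · exact hxmem i
      · have := hxmem i.castSucc
        have := hxb i
        simp only [z, Sum.elim_inr, Set.mem_Icc] at *
        constructor <;> linarith
    let p := Lagrange.interpolate univ z fun i => f (z i)
    have hpd : p.natDegree ≤ 2 * n := by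
      refine natDegree_le_of_degree_le ((Lagrange.degree_interpolate_le _ hz.injOn).trans ?_)
      rw [card_univ, hcard, Nat.add_sub_cancel]
    have hpz : ∀ i, p.eval (z i) = f (z i) := fun i =>
      Lagrange.eval_interpolate_at_node (fun i => f (z i)) hz.injOn (mem_univ i)
    refine ⟨p, hpd, fun i => hpz (Sum.inl i), fun t ht hti => ?_⟩
    have htz : ∀ i, t ≠ z i := by
      rintro (i | i) rfl
      · simpa [z] using hti i
      · simpa [z] using hti i.castSucc
    have hmain := hf.sub_eval_div_prod_sub_nonneg hcard hz hzs hpd hpz ht htz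
    have hneg : ∏ i, (t - z i) < 0 := by
      rw [Fintype.prod_sum_type, Fin.prod_univ_castSucc, mul_right_comm, ← prod_mul_distrib]
      refine mul_neg_of_pos_of_neg (prod_pos fun i _ => ?_) ?_
      · simpa only [z, Sum.elim_inl, Sum.elim_inr, ← sub_sub] using hti i.castSucc
      · have h1 := htz (Sum.inl (Fin.last n))
        simp only [z, Sum.elim_inl, hxl] at h1 ⊢
        exact sub_neg.2 (lt_of_le_of_ne ht.2 h1)
    by_contra! hlt
    exact (div_neg_of_pos_of_neg (sub_pos.2 hlt) hneg).not_ge hmain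
  let h : ℕ → ℝ := fun m => g / 3 / ((m : ℝ) + 1)
  have hh0 : ∀ m, 0 < h m := fun m => by positivity
  have hh1 : ∀ m, h m ≤ g / 3 := fun m => div_le_self (by positivity) (by simp)
  have hh : Tendsto h atTop (𝓝 0) := by
    simpa [h, div_eq_mul_inv] using
      (tendsto_one_div_add_atTop_nhds_zero_nat (𝕜 := ℝ)).const_mul (g / 3)
  choose q hqd hqx hqt using fun m => key (h m) (hh0 m) (by linarith [hh1 m])
  have hxg : ∀ i j, i ≠ j → g / 2 < |x i - x j| := fun i j hij => by linarith [hgx i j hij]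
  have hq_shift : ∀ m i, f (x i - g / 2) ≤ (q m).eval (x i - g / 2) := fun m i => by
    refine hqt m _ ⟨by linarith [hga i], by linarith [(hxmem i).2]⟩ fun j => ?_
    have h0 := hh0 m
    have h1 := hh1 m
    rcases eq_or_ne i j with rfl | hij
    · exact mul_pos_of_neg_of_neg (by linarith) (by linarith)
    · rcases lt_abs.1 (hgx i j hij) with h2 | h2
      · exact mul_pos (by linarith) (by linarith)
      · exact mul_pos_of_neg_of_neg (by linarith) (by linarith)
  choose M hM using eval_le_of_eval_eq_of_le_eval_shift (half_pos hg) hxg f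
  have hcard : Fintype.card (Fin (n + 1) ⊕ Fin (n + 1)) = 2 * n + 2 := by
    simp only [Fintype.card_sum, Fintype.card_fin]; omega
  have hinj : Function.Injective (Sum.elim x fun i => x i - g / 2) := by
    refine hxinj.sumElim (fun i j hij => hxinj (sub_left_injective hij)) fun i j hij => ?_
    have hne : i ≠ j := by
      rintro rfl
      linarith
    have := hxg i j hne
    rw [hij, sub_sub_cancel_left, abs_neg, abs_of_pos (half_pos hg)] at this
    exact this.false
  obtain ⟨p, φ, hφ, hp⟩ := exists_tendsto_subseq_of_eval_mem_Icc hinj (q := q)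
    (fun m => by have := hqd m; omega)
    (l := Sum.elim (fun i => f (x i)) fun i => f (x i - g / 2))
    (u := Sum.elim (fun i => f (x i)) M) (by
      rintro m (i | i)
      · simp [hqx]
      · exact ⟨hq_shift m i, hM i (q m) (by have := hqd m; omega) (hqx m) (hq_shift m)⟩)
  have hpe : ∀ t, Tendsto (fun m => (q (φ m)).eval t) atTop (𝓝 (p.eval t)) := fun t =>
    hp (leval t)
  have hpx : ∀ i, p.eval (x i) = f (x i) := fun i =>
    tendsto_nhds_unique (hpe (x i)) (by simp only [hqx]; exact tendsto_const_nhds)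
  refine ⟨p, natDegree_le_iff_coeff_eq_zero.2 fun k hk => ?_, hpx, fun t ht => ?_⟩
  · refine tendsto_nhds_unique (hp (lcoeff ℝ k)) (tendsto_const_nhds.congr fun m => ?_)
    exact (coeff_eq_zero_of_natDegree_lt ((hqd _).trans_lt hk)).symm
  · by_cases htx : ∃ i, t = x i
    · obtain ⟨i, rfl⟩ := htx
      exact (hpx i).ge
    · push Not at htx
      refine ge_of_tendsto (hpe t) ?_
      have hev : ∀ᶠ m in atTop, ∀ i, 0 < (t - x i) * (t - x i - h (φ m)) := by
        refine eventually_all.2 fun i => ?_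
        have hlim : Tendsto (fun m => (t - x i) * (t - x i - h (φ m))) atTop
            (𝓝 ((t - x i) * (t - x i - 0))) :=
          ((hh.comp hφ.tendsto_atTop).const_sub _).const_mul _
        refine hlim.eventually_const_lt ?_
        rw [sub_zero]
        exact mul_self_pos.2 (sub_ne_zero.2 (htx i))
      filter_upwards [hev] with m hm using hqt (φ m) t ht hm
end

section
/- Fix n ∈ ℕ, n ≥ 1. Let x_1,…,x_n be pairwise distinct points of (−1,1) with weights w_1,…,w_n ∈ ℝ such that Σ_{i=1}^n w_i p(x_i) = ∫_{−1}^{1} p(x)dx for every polynomial p of degree at most 2n−1 (a Gauss-type rule), and let y_1 = −1, y_{n+1} = 1, y_2,…,y_n pairwise distinct points of (−1,1), with weights v_1,…,v_{n+1} ∈ ℝ such that Σ_{i=1}^{n+1} v_i p(y_i) = ∫_{−1}^{1} p(x)dx for every polynomial p of degree at most 2n−1 (a Lobatto-type rule). Let T be a positive linear functional, defined on a linear subspace of the space of functions [−1,1] → ℝ that contains all polynomials and all (2n−1)-convex functions, which is exact on Π_{2n−1}. Then for every (2n−1)-convex function f : [−1,1] → ℝ one has Σ_{i=1}^n w_i f(x_i)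 ≤ T(f) ≤ Σ_{i=1}^{n+1} v_i f(y_i). -/
/-- The divided difference of `f` at the points of the finite set `S`. -/
noncomputable def dividedDiff (f : ℝ → ℝ) (S : Finset ℝ) : ℝ :=
  ∑ a ∈ S, f a / ∏ b ∈ S.erase a, (a - b)

section DividedDiff

open Finset Polynomial

variable {f : ℝ → ℝ}

lemma NConvexOn.dividedDiff_nonneg {m : ℕ} {s : Set ℝ} (hf : NConvexOn m s f)
    {S : Finset ℝ} (hS : ∀ a ∈ S, a ∈ s) (hcard : S.card = m + 2) :
    0 ≤ dividedDiff f S := by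
  let e : Fin (m + 2) ↪ ℝ := (S.orderEmbOfFin hcard).toEmbedding
  have hmap : univ.map e = S := by
    simp [e]
  have h := hf e e.injective fun i => hS _ (S.orderEmbOfFin_mem hcard i)
  rw [dividedDiff, ← hmap, sum_map]
  convert h using 3 with i
  rw [← map_erase, prod_map]

lemma dividedDiff_insert {R : Finset ℝ} {t : ℝ} (ht : t ∉ R) :
    dividedDiff f (insert t R) = f t / ∏ b ∈ R, (t - b) +
      ∑ a ∈ R, f a / ((a - t) * ∏ b ∈ R.erase a, (a - b)) := by
  rw [dividedDiff, sum_insert ht, erase_insert ht]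
  congr 1
  refine sum_congr rfl fun a ha => ?_
  have hat : a ≠ t := fun h => ht (h ▸ ha)
  rw [erase_insert_of_ne hat.symm, prod_insert (fun h => ht (mem_of_mem_erase h))]

lemma dividedDiff_sub_dividedDiff {R : Finset ℝ} {t z : ℝ} (ht : t ∉ R) (hz : z ∉ R)
    (htz : t ≠ z) :
    dividedDiff f (insert t R) - dividedDiff f (insert z R) =
      (t - z) * dividedDiff f (insert t (insert z R)) := by
  have htz' : t ∉ insert z R := by simp [htz, ht]
  have h1 : t - z ≠ 0 := sub_ne_zero.2 htz
  have h2 : z - t ≠ 0 := sub_ne_zero.2 htz.symm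
  have hpt : ∏ b ∈ R, (t - b) ≠ 0 :=
    prod_ne_zero_iff.2 fun b hb => sub_ne_zero.2 fun h => ht (h ▸ hb)
  have hpz : ∏ b ∈ R, (z - b) ≠ 0 :=
    prod_ne_zero_iff.2 fun b hb => sub_ne_zero.2 fun h => hz (h ▸ hb)
  rw [dividedDiff_insert htz', dividedDiff_insert ht, dividedDiff_insert hz, sum_insert hz,
    prod_insert hz, erase_insert hz, mul_add, mul_add, mul_sum]
  have hsum : ∑ a ∈ R, (t - z) * (f a / ((a - t) * ∏ b ∈ (insert z R).erase a, (a - b))) =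
      ∑ a ∈ R, f a / ((a - t) * ∏ b ∈ R.erase a, (a - b)) -
        ∑ a ∈ R, f a / ((a - z) * ∏ b ∈ R.erase a, (a - b)) := by
    rw [← sum_sub_distrib]
    refine sum_congr rfl fun a ha => ?_
    have hat : a - t ≠ 0 := sub_ne_zero.2 fun h => ht (h ▸ ha)
    have haz' : a ≠ z := fun h => hz (h ▸ ha)
    have haz : a - z ≠ 0 := sub_ne_zero.2 haz'
    rw [erase_insert_of_ne haz'.symm, prod_insert (fun h => hz (mem_of_mem_erase h))]
    have hpa : ∏ b ∈ R.erase a, (a - b) ≠ 0 :=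
      prod_ne_zero_iff.2 fun b hb => sub_ne_zero.2 (ne_of_mem_erase hb).symm
    field_simp
    ring
  rw [hsum]
  have e1 : (t - z) * (f t / ((t - z) * ∏ b ∈ R, (t - b))) = f t / ∏ b ∈ R, (t - b) := by
    field_simp
  have e2 : (t - z) * (f z / ((z - t) * ∏ b ∈ R, (z - b))) = -(f z / ∏ b ∈ R, (z - b)) := by
    field_simp
    ring
  rw [e1, e2]
  ring

lemma sub_eval_interpolate {S : Finset ℝ} {t : ℝ} (ht : t ∉ S) :
    f t - (Lagrange.interpolate S id f).eval t =
      dividedDiff f (insert t S) * ∏ b ∈ S, (t - b) := by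
  have hpt : ∏ b ∈ S, (t - b) ≠ 0 :=
    prod_ne_zero_iff.2 fun b hb => sub_ne_zero.2 fun h => ht (h ▸ hb)
  have hsum : ∑ a ∈ S, Lagrange.nodalWeight S id a * (t - id a)⁻¹ * f a =
      -∑ a ∈ S, f a / ((a - t) * ∏ b ∈ S.erase a, (a - b)) := by
    rw [← sum_neg_distrib]
    refine sum_congr rfl fun a ha => ?_
    have hat : a - t ≠ 0 := sub_ne_zero.2 fun h => ht (h ▸ ha)
    have hta : t - a ≠ 0 := sub_ne_zero.2 fun h => ht (h ▸ ha)
    have hpa : ∏ b ∈ S.erase a, (a - b) ≠ 0 :=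
      prod_ne_zero_iff.2 fun b hb => sub_ne_zero.2 (ne_of_mem_erase hb).symm
    simp only [Lagrange.nodalWeight, id, prod_inv_distrib]
    field_simp
    ring
  rw [dividedDiff_insert ht,
    Lagrange.eval_interpolate_not_at_node f (fun i hi h => ht (by simpa [h] using hi)),
    Lagrange.eval_nodal, hsum, add_mul, div_mul_cancel₀ _ hpt]
  simp only [id]
  ring

lemma NConvexOn.dividedDiff_insert_le {m : ℕ} {s : Set ℝ} (hf : NConvexOn m s f)
    {R : Finset ℝ} (hR : ∀ a ∈ R, a ∈ s) (hcard : R.card = m) {z t : ℝ} (hzs : z ∈ s)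
    (hts : t ∈ s) (hz : z ∉ R) (ht : t ∉ R) (hzt : z ≤ t) :
    dividedDiff f (insert z R) ≤ dividedDiff f (insert t R) := by
  rcases hzt.eq_or_lt with rfl | hlt
  · rfl
  rw [← sub_nonneg, dividedDiff_sub_dividedDiff ht hz hlt.ne']
  have htz : t ∉ insert z R := by simp [hlt.ne', ht]
  refine mul_nonneg (sub_nonneg.2 hzt) (hf.dividedDiff_nonneg ?_ ?_)
  · simpa [hzs, hts] using hR
  · rw [card_insert_of_notMem htz, card_insert_of_notMem hz, hcard]

lemma NConvexOn.dividedDiff_union_image_le {m : ℕ} {s : Set ℝ} (hf : NConvexOn m s f)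
    {B : Finset ℝ} {u v : ℝ → ℝ} (hle : ∀ b ∈ B, u b ≤ v b)
    (hus : ∀ b ∈ B, u b ∈ s) (hvs : ∀ b ∈ B, v b ∈ s)
    (hu : Set.InjOn u B) (hv : Set.InjOn v B)
    (huv : ∀ b ∈ B, ∀ b' ∈ B, b ≠ b' → u b ≠ v b') :
    ∀ R : Finset ℝ, (∀ a ∈ R, a ∈ s) → (∀ b ∈ B, u b ∉ R) → (∀ b ∈ B, v b ∉ R) →
      R.card + B.card = m + 1 →
      dividedDiff f (R ∪ B.image u) ≤ dividedDiff f (R ∪ B.image v) := by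
  induction B using Finset.induction_on with
  | empty => simp
  | insert b B hb ih =>
    intro R hR huR hvR hcard
    simp only [mem_insert, forall_eq_or_imp] at hle hus hvs huR hvR huv
    have hu' : Set.InjOn u B := hu.mono (by simp)
    have hv' : Set.InjOn v B := hv.mono (by simp)
    have hub : ∀ c ∈ B, u c ≠ u b := fun c hc h =>
      hb (hu (by simp [hc]) (by simp) h ▸ hc)
    have hvb : ∀ c ∈ B, v c ≠ v b := fun c hc h =>
      hb (hv (by simp [hc]) (by simp) h ▸ hc)
    have hne : ∀ c ∈ B, b ≠ c := fun c hc h => hb (h ▸ hc)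
    have huvb : ∀ c ∈ B, v c ≠ u b := fun c hc h => huv.1.2 c hc (hne c hc) h.symm
    have hcard' := card_insert_of_notMem hb
    have h1 := ih hle.2 hus.2 hvs.2 hu' hv' (fun c hc => (huv.2 c hc).2) (insert (u b) R)
      (by simpa [hus.1] using hR)
      (fun c hc => by simp [hub c hc, huR.2 c hc])
      (fun c hc => by simp [huvb c hc, hvR.2 c hc])
      (by rw [card_insert_of_notMem huR.1]; omega)
    have hdisj : Disjoint R (B.image v) := by
      rw [disjoint_right]
      simpa using hvR.2
    have h2 := hf.dividedDiff_insert_le (R := R ∪ B.image v) (z := u b) (t := v b)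
      (by
        intro a ha
        rcases mem_union.1 ha with ha | ha
        · exact hR a ha
        · obtain ⟨c, hc, rfl⟩ := mem_image.1 ha
          exact hvs.2 c hc)
      (by rw [card_union_of_disjoint hdisj, card_image_of_injOn hv']; omega)
      hus.1 hvs.1 (by simpa [huR.1] using huvb) (by simpa [hvR.1] using hvb) hle.1
    rw [image_insert, image_insert, union_insert, union_insert]
    rw [insert_union, insert_union] at h1
    exact h1.trans h2

lemma exists_separation {R B : Finset ℝ} (hB : ∀ b ∈ B, b ∈ Set.Ioo (-1 : ℝ) 1) :
    ∃ δ > 0, ∀ b ∈ B, -1 < b - δ ∧ b + δ < 1 ∧ ∀ s ∈ R, s ≠ b → 2 * δ < |s - b| := by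
  have h : ∀ᶠ δ in nhdsWithin (0 : ℝ) (Set.Ioi 0),
      ∀ b ∈ B, -1 < b - δ ∧ b + δ < 1 ∧ ∀ s ∈ R, s ≠ b → 2 * δ < |s - b| := by
    refine (Finset.eventually_all B).2 fun b hb => ?_
    have hsmall : ∀ c : ℝ, 0 < c → ∀ᶠ δ in nhdsWithin (0 : ℝ) (Set.Ioi 0), δ < c :=
      fun c hc => nhdsWithin_le_nhds (gt_mem_nhds hc)
    refine ((hsmall (b + 1) (by linarith [(hB b hb).1])).mono fun _ _ => by linarith).and
      (((hsmall (1 - b) (by linarith [(hB b hb).2])).mono fun _ _ => by linarith).and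
        ((Finset.eventually_all R).2 fun s _ => ?_))
    by_cases hsb : s = b
    · simp [hsb]
    · exact (hsmall (|s - b| / 2) (by have := abs_pos.2 (sub_ne_zero.2 hsb); positivity)).mono
        fun _ _ _ => by linarith
  obtain ⟨δ, hδ, hpos⟩ := (h.and self_mem_nhdsWithin).exists
  exact ⟨δ, hpos, hδ⟩

/-- Divided differences of an `m`-convex function stay bounded as pairs of nodes coalesce. -/
lemma NConvexOn.exists_abs_dividedDiff_le {m : ℕ} (hf : NConvexOn m (Set.Icc (-1 : ℝ) 1) f)
    {R B : Finset ℝ} (hBR : B ⊆ R) (hR : ∀ a ∈ R, a ∈ Set.Icc (-1 : ℝ) 1)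
    (hcard : R.card + B.card = m + 1) {δ : ℝ} (hδ : 0 < δ)
    (hsep : ∀ b ∈ B, -1 < b - δ ∧ b + δ < 1 ∧ ∀ s ∈ R, s ≠ b → 2 * δ < |s - b|) :
    ∃ M, ∀ u : ℝ → ℝ, (∀ b ∈ B, b < u b ∧ u b ≤ b + δ) →
      |dividedDiff f (R ∪ B.image u)| ≤ M := by
  have main : ∀ u v : ℝ → ℝ, (∀ b ∈ B, u b ≤ v b) →
      (∀ b ∈ B, u b ≠ b ∧ |u b - b| ≤ δ) → (∀ b ∈ B, v b ≠ b ∧ |v b - b| ≤ δ) →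
      dividedDiff f (R ∪ B.image u) ≤ dividedDiff f (R ∪ B.image v) := by
    have hmem : ∀ u : ℝ → ℝ, (∀ b ∈ B, u b ≠ b ∧ |u b - b| ≤ δ) →
        ∀ b ∈ B, u b ∈ Set.Icc (-1 : ℝ) 1 := fun u hu b hb => by
      have h1 := abs_le.1 (hu b hb).2
      have h2 := hsep b hb
      exact ⟨by linarith, by linarith⟩
    have hnotin : ∀ u : ℝ → ℝ, (∀ b ∈ B, u b ≠ b ∧ |u b - b| ≤ δ) →
        ∀ b ∈ B, u b ∉ R := fun u hu b hb hR => by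
      have := (hsep b hb).2.2 _ hR (hu b hb).1
      linarith [(hu b hb).2]
    have hne : ∀ u v : ℝ → ℝ, (∀ b ∈ B, u b ≠ b ∧ |u b - b| ≤ δ) →
        (∀ b ∈ B, v b ≠ b ∧ |v b - b| ≤ δ) → ∀ b ∈ B, ∀ b' ∈ B, b ≠ b' → u b ≠ v b' := by
      intro u v hu hv b hb b' hb' hbb h
      have h1 := (hsep b' hb').2.2 b (hBR hb) hbb
      have h2 := (hu b hb).2
      have h3 := (hv b' hb').2
      rw [← h] at h3
      rw [abs_sub_comm] at h2
      linarith [abs_sub_le b (u b) b']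
    intro u v huv hu hv
    have hinj : ∀ u : ℝ → ℝ, (∀ b ∈ B, u b ≠ b ∧ |u b - b| ≤ δ) → Set.InjOn u B :=
      fun u hu b hb b' hb' h => by_contra fun hbb => hne u u hu hu b hb b' hb' hbb h
    exact hf.dividedDiff_union_image_le huv (hmem u hu) (hmem v hv) (hinj u hu) (hinj v hv)
      (hne u v hu hv) R hR (hnotin u hu) (hnotin v hv) hcard
  refine ⟨max |dividedDiff f (R ∪ B.image fun b => b - δ)|
    |dividedDiff f (R ∪ B.image fun b => b + δ)|, fun u hu => abs_le_max_abs_abs ?_ ?_⟩ <;>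
  refine main _ _ (fun b hb => ?_) (fun b hb => ?_) (fun b hb => ?_) <;>
  have hub := hu b hb
  · linarith
  · exact ⟨by linarith, by simp [abs_of_pos hδ]⟩
  · exact ⟨hub.1.ne', abs_le.2 ⟨by linarith, by linarith⟩⟩
  · exact hub.2
  · exact ⟨hub.1.ne', abs_le.2 ⟨by linarith, by linarith⟩⟩
  · exact ⟨by linarith, by simp [abs_of_pos hδ]⟩

/-- An `m`-convex function admits, up to `ε`, one-sided polynomial approximations of degree at
most `m` interpolating it at the points of `R`, where the points of `B` count as double nodes. -/
lemma NConvexOn.exists_interpolating_polynomial {m : ℕ}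
    (hf : NConvexOn m (Set.Icc (-1 : ℝ) 1) f)
    {R B : Finset ℝ} (hBR : B ⊆ R) (hR : ∀ a ∈ R, a ∈ Set.Icc (-1 : ℝ) 1)
    (hB : ∀ b ∈ B, b ∈ Set.Ioo (-1 : ℝ) 1)
    (hcard : R.card + B.card = m + 1) {σ : ℝ} (hσ : |σ| = 1)
    (hsign : ∀ t ∈ Set.Icc (-1 : ℝ) 1, 0 ≤ σ * ∏ s ∈ R \ B, (t - s)) {ε : ℝ} (hε : 0 < ε) :
    ∃ p : ℝ[X], p.natDegree ≤ m ∧ (∀ s ∈ R, p.eval s = f s) ∧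
      ∀ t ∈ Set.Icc (-1 : ℝ) 1, -ε ≤ σ * (f t - p.eval t) := by
  obtain ⟨δ, hδ, hsep⟩ := exists_separation (R := R) hB
  obtain ⟨M, hM⟩ := hf.exists_abs_dividedDiff_le hBR hR hcard hδ hsep
  have hM0 : 0 ≤ M := (abs_nonneg _).trans (hM (fun b => b + δ) fun b _ => ⟨by linarith, le_rfl⟩)
  obtain ⟨h, hh, hhδ, hhε⟩ : ∃ h > 0, h ≤ δ ∧ 2 * M * (h * 2 ^ m) ≤ ε := by
    refine ⟨min δ (ε / (2 * M * 2 ^ m + 1)), by positivity, min_le_left _ _, ?_⟩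
    have h1 := min_le_right δ (ε / (2 * M * 2 ^ m + 1))
    rw [le_div_iff₀ (by positivity)] at h1
    have h2 : 0 < min δ (ε / (2 * M * 2 ^ m + 1)) := by positivity
    nlinarith
  have hshift : ∀ b ∈ B, b + h ∉ R := fun b hb hR => by
    have h1 := (hsep b hb).2.2 _ hR (by linarith)
    rw [add_sub_cancel_left, abs_of_pos hh] at h1
    linarith
  have hdisj : Disjoint R (B.image (· + h)) := by
    rw [disjoint_right, forall_mem_image]
    exact hshift
  have hinj : Function.Injective (· + h : ℝ → ℝ) := add_left_injective h
  set S := R ∪ B.image (· + h) with hS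
  have hScard : S.card = m + 1 := by
    rw [hS, card_union_of_disjoint hdisj, card_image_of_injective _ hinj, hcard]
  have hSI : ∀ a ∈ S, a ∈ Set.Icc (-1 : ℝ) 1 := by
    intro a ha
    rcases mem_union.1 ha with ha | ha
    · exact hR a ha
    · obtain ⟨b, hb, rfl⟩ := mem_image.1 ha
      have := hsep b hb
      exact ⟨by linarith, by linarith⟩
  have hval : ∀ s ∈ S, (Lagrange.interpolate S id f).eval s = f s := fun s hs =>
    Lagrange.eval_interpolate_at_node f (Set.injOn_id _) hs
  refine ⟨Lagrange.interpolate S id f, ?_, fun s hs => hval s (mem_union_left _ hs), ?_⟩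
  · refine natDegree_le_of_degree_le ?_
    have := Lagrange.degree_interpolate_le (s := S) (v := id) f (Set.injOn_id _)
    rwa [hScard] at this
  intro t ht
  by_cases htS : t ∈ S
  · rw [hval t htS]
    simpa using hε.le
  rw [sub_eval_interpolate htS]
  have hnn : 0 ≤ dividedDiff f (insert t S) := hf.dividedDiff_nonneg (by
    simp only [mem_insert, forall_eq_or_imp]
    exact ⟨ht, hSI⟩) (by rw [card_insert_of_notMem htS, hScard])
  by_cases hin : ∃ b ∈ B, b < t ∧ t < b + h
  · obtain ⟨b, hb, hbt, htb⟩ := hin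
    have hbS : b + h ∈ S := mem_union_right _ (mem_image_of_mem _ hb)
    have htQ : t ∉ S.erase (b + h) := fun h => htS (mem_of_mem_erase h)
    have hdd := dividedDiff_sub_dividedDiff (f := f) htQ (notMem_erase (b + h) S) htb.ne
    rw [insert_erase hbS] at hdd
    have hmove : insert t (S.erase (b + h)) =
        R ∪ B.image fun c => if c = b then t else c + h := by
      ext a
      simp only [hS, mem_insert, mem_erase, mem_union, mem_image]
      constructor
      · rintro (rfl | ⟨hne, ha | ⟨c, hc, rfl⟩⟩)
        · exact Or.inr ⟨b, hb, by simp⟩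
        · exact Or.inl ha
        · exact Or.inr ⟨c, hc, if_neg fun hcb => hne (by rw [hcb])⟩
      · rintro (ha | ⟨c, hc, rfl⟩)
        · exact Or.inr ⟨fun hab => hshift b hb (hab ▸ ha), Or.inl ha⟩
        · split_ifs with hcb
          · exact Or.inl rfl
          · exact Or.inr ⟨fun heq => hcb (hinj heq), Or.inr ⟨c, hc, rfl⟩⟩
    have hb1 : |dividedDiff f (insert t (S.erase (b + h)))| ≤ M := by
      rw [hmove]
      refine hM _ fun c _ => ?_
      split_ifs with hcb
      · subst hcb
        exact ⟨hbt, by linarith⟩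
      · exact ⟨by linarith, by linarith⟩
    have hb2 : |dividedDiff f S| ≤ M :=
      hM (· + h) fun c _ => ⟨by simpa using hh, by simpa using hhδ⟩
    have hbQ : b ∈ S.erase (b + h) :=
      mem_erase.2 ⟨by linarith, mem_union_left _ (hBR hb)⟩
    have hprod : |∏ c ∈ S.erase (b + h), (t - c)| ≤ h * 2 ^ m := by
      rw [← mul_prod_erase _ _ hbQ, abs_mul, abs_prod]
      have hrest : ∏ c ∈ (S.erase (b + h)).erase b, |t - c| ≤ 2 ^ m := by
        refine (prod_le_prod (fun _ _ => abs_nonneg _) (g := fun _ => 2) fun c hc => ?_).trans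
          ((prod_const _).trans_le (pow_le_pow_right₀ one_le_two ?_))
        · have := hSI c (mem_of_mem_erase (mem_of_mem_erase hc))
          exact abs_le.2 ⟨by linarith [ht.1, this.2], by linarith [ht.2, this.1]⟩
        · rw [card_erase_of_mem hbQ, card_erase_of_mem hbS]
          omega
      exact mul_le_mul (abs_le.2 ⟨by linarith, by linarith⟩) hrest
        (prod_nonneg fun _ _ => abs_nonneg _) hh.le
    have heq : dividedDiff f (insert t S) * ∏ c ∈ S, (t - c) =
        (dividedDiff f (insert t (S.erase (b + h))) - dividedDiff f S) *
          ∏ c ∈ S.erase (b + h), (t - c) := by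
      rw [hdd, ← mul_prod_erase _ _ hbS]
      ring
    rw [heq]
    refine neg_le_of_abs_le (le_trans ?_ hhε)
    rw [abs_mul, abs_mul, hσ, one_mul]
    refine mul_le_mul ((abs_sub _ _).trans (by linarith)) hprod (abs_nonneg _) (by positivity)
  · have hpair : 0 ≤ ∏ b ∈ B, ((t - b) * (t - (b + h))) := by
      refine prod_nonneg fun b hb => ?_
      by_cases hbt : b < t
      · have : b + h ≤ t := not_lt.1 fun hlt => hin ⟨b, hb, hbt, hlt⟩
        exact mul_nonneg (by linarith) (by linarith)
      · exact mul_nonneg_of_nonpos_of_nonpos (by linarith) (by linarith)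
    have hfac : ∏ c ∈ S, (t - c) =
        (∏ s ∈ R \ B, (t - s)) * ∏ b ∈ B, ((t - b) * (t - (b + h))) := by
      rw [hS, prod_union hdisj, prod_image (fun _ _ _ _ he => hinj he), prod_mul_distrib,
        ← prod_sdiff hBR]
      ring
    rw [hfac]
    have := mul_nonneg hnn (mul_nonneg (hsign t ht) hpair)
    linarith

end DividedDiff

/-- A positive functional agreeing with a quadrature rule on `Π_m` is bounded on one side by that
rule at every function having one-sided interpolating polynomials up to `ε`. -/
lemma quadrature_le_of_approx {ι : Type*} [Fintype ι] {m : ℕ} {z c : ι → ℝ}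
    (hQ : ∀ p : Polynomial ℝ, p.natDegree ≤ m →
      ∑ i, c i * p.eval (z i) = ∫ t in (-1 : ℝ)..1, p.eval t)
    {E : Submodule ℝ (ℝ → ℝ)} {T : E →ₗ[ℝ] ℝ}
    (hEpoly : ∀ p : Polynomial ℝ, (fun t : ℝ => p.eval t) ∈ E)
    (hTpos : ∀ g h : E, (∀ t ∈ Set.Icc (-1 : ℝ) 1, (g : ℝ → ℝ) t ≤ (h : ℝ → ℝ) t) →
      T g ≤ T h)
    (hTexact : ∀ p : Polynomial ℝ, p.natDegree ≤ m →
      T ⟨fun t : ℝ => p.eval t, hEpoly p⟩ = ∫ t in (-1 : ℝ)..1, p.eval t)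
    (F : E)
    (h : ∀ ε > 0, ∃ p : Polynomial ℝ, p.natDegree ≤ m ∧
      (∀ i, p.eval (z i) = (F : ℝ → ℝ) (z i)) ∧
      ∀ t ∈ Set.Icc (-1 : ℝ) 1, -ε ≤ (F : ℝ → ℝ) t - p.eval t) :
    ∑ i, c i * (F : ℝ → ℝ) (z i) ≤ T F := by
  refine le_of_forall_pos_le_add fun ε hε => ?_
  obtain ⟨p, hdeg, hval, hle⟩ := h (ε / 2) (by positivity)
  have hdeg' : (p - Polynomial.C (ε / 2)).natDegree ≤ m := by
    rwa [Polynomial.natDegree_sub_C]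
  have h1 := hTpos ⟨_, hEpoly (p - Polynomial.C (ε / 2))⟩ F fun t ht => by
    have := hle t ht
    simp only [Polynomial.eval_sub, Polynomial.eval_C]
    linarith
  rw [hTexact _ hdeg', ← hQ _ hdeg'] at h1
  have h2 : ∑ i, c i = 2 := by
    have := hQ 1 (by simp)
    norm_num at this
    exact this
  simp only [Polynomial.eval_sub, Polynomial.eval_C, mul_sub, Finset.sum_sub_distrib,
    ← Finset.sum_mul, h2, hval] at h1
  linarith

/-- Theorem (Gauss–Lobatto extremality): if `T` is a positive linear functional,
defined on a subspace of functions `[-1,1] → ℝ` containing all polynomials and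
all `(2n-1)`-convex functions, which is exact on `Π_{2n-1}`, then for every
`(2n-1)`-convex `f` one has `G_n(f) ≤ T(f) ≤ Lob_{n+1}(f)` for any Gauss-type
rule `(x, w)` and Lobatto-type rule `(y, v)` exact on `Π_{2n-1}`. -/
theorem gauss_le_positive_functional_le_lobatto
    (n : ℕ) (hn : 1 ≤ n)
    (x : Fin n → ℝ) (hxinj : Function.Injective x)
    (hx : ∀ i, x i ∈ Set.Ioo (-1 : ℝ) 1) (w : Fin n → ℝ)
    (hG : ∀ p : Polynomial ℝ, p.natDegree ≤ 2 * n - 1 →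
      ∑ i, w i * p.eval (x i) = ∫ t in (-1 : ℝ)..1, p.eval t)
    (y : Fin (n + 1) → ℝ) (hyinj : Function.Injective y)
    (hy0 : y 0 = -1) (hyl : y (Fin.last n) = 1)
    (hy : ∀ i, i ≠ 0 → i ≠ Fin.last n → y i ∈ Set.Ioo (-1 : ℝ) 1)
    (v : Fin (n + 1) → ℝ)
    (hL : ∀ p : Polynomial ℝ, p.natDegree ≤ 2 * n - 1 →
      ∑ i, v i * p.eval (y i) = ∫ t in (-1 : ℝ)..1, p.eval t)
    (E : Submodule ℝ (ℝ → ℝ)) (T : E →ₗ[ℝ] ℝ)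
    (hEpoly : ∀ p : Polynomial ℝ, (fun t : ℝ => p.eval t) ∈ E)
    (hEconv : ∀ g : ℝ → ℝ, NConvexOn (2 * n - 1) (Set.Icc (-1 : ℝ) 1) g → g ∈ E)
    (hTpos : ∀ g h : E, (∀ t ∈ Set.Icc (-1 : ℝ) 1, (g : ℝ → ℝ) t ≤ (h : ℝ → ℝ) t) →
      T g ≤ T h)
    (hTexact : ∀ p : Polynomial ℝ, p.natDegree ≤ 2 * n - 1 →
      T ⟨fun t : ℝ => p.eval t, hEpoly p⟩ = ∫ t in (-1 : ℝ)..1, p.eval t)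
    (f : ℝ → ℝ) (hf : NConvexOn (2 * n - 1) (Set.Icc (-1 : ℝ) 1) f) :
    ∑ i, w i * f (x i) ≤ T ⟨f, hEconv f hf⟩ ∧
      T ⟨f, hEconv f hf⟩ ≤ ∑ i, v i * f (y i) := by
  constructor
  · refine quadrature_le_of_approx hG hEpoly hTpos hTexact ⟨f, hEconv f hf⟩ fun ε hε => ?_
    have hmem : ∀ b ∈ Finset.univ.image x, b ∈ Set.Ioo (-1 : ℝ) 1 := by simpa using hx
    obtain ⟨p, hdeg, hval, hle⟩ := hf.exists_interpolating_polynomial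
      (Finset.Subset.refl (Finset.univ.image x)) (fun b hb => Set.Ioo_subset_Icc_self (hmem b hb))
      hmem (by rw [Finset.card_image_of_injective _ hxinj, Finset.card_fin]; omega)
      (σ := 1) (by simp) (by simp) hε
    exact ⟨p, hdeg, fun i => hval _ (by simp), by simpa using hle⟩
  · have h0l : (0 : Fin (n + 1)) ≠ Fin.last n := fun h => by
      have := congrArg y h
      rw [hy0, hyl] at this
      norm_num at this
    have hB : ∀ b ∈ (Finset.univ \ {0, Fin.last n} : Finset (Fin (n + 1))).image y,
        b ∈ Set.Ioo (-1 : ℝ) 1 := by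
      intro b hb
      obtain ⟨i, hi, rfl⟩ := Finset.mem_image.1 hb
      simp only [Finset.mem_sdiff, Finset.mem_univ, true_and, Finset.mem_insert,
        Finset.mem_singleton, not_or] at hi
      exact hy i hi.1 hi.2
    have hR : ∀ b ∈ Finset.univ.image y, b ∈ Set.Icc (-1 : ℝ) 1 := by
      intro b hb
      obtain ⟨i, -, rfl⟩ := Finset.mem_image.1 hb
      by_cases h0 : i = 0
      · simp [h0, hy0]
      by_cases hl : i = Fin.last n
      · simp [hl, hyl]
      exact Set.Ioo_subset_Icc_self (hy i h0 hl)
    have hsdiff : Finset.univ.image y \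
        (Finset.univ \ {0, Fin.last n} : Finset (Fin (n + 1))).image y = {-1, 1} := by
      rw [← Finset.image_sdiff _ _ hyinj, sdiff_sdiff_right_self]
      simp [hy0, hyl]
    have hneg := quadrature_le_of_approx hL hEpoly hTpos hTexact (-⟨f, hEconv f hf⟩)
      fun ε hε => ?_
    · rw [map_neg] at hneg
      simp only [Submodule.coe_neg, Pi.neg_apply, mul_neg, Finset.sum_neg_distrib] at hneg
      exact neg_le_neg_iff.1 hneg
    have hcard : (Finset.univ.image y).card +
        ((Finset.univ \ {0, Fin.last n} : Finset (Fin (n + 1))).image y).card =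
          2 * n - 1 + 1 := by
      rw [Finset.card_image_of_injective _ hyinj, Finset.card_image_of_injective _ hyinj,
        Finset.card_sdiff_of_subset (Finset.subset_univ _), Finset.card_pair h0l, Finset.card_fin]
      omega
    obtain ⟨p, hdeg, hval, hle⟩ := hf.exists_interpolating_polynomial
      (Finset.image_subset_image Finset.sdiff_subset) hR hB hcard (σ := -1) (by simp)
      (by
        intro t ht
        rw [hsdiff, Finset.prod_pair (by norm_num)]
        nlinarith [ht.1, ht.2]) hε
    refine ⟨-p, by rwa [Polynomial.natDegree_neg], fun i => ?_, fun t ht => ?_⟩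
    · simp [hval (y i) (by simp)]
    · have := hle t ht
      simp only [Polynomial.eval_neg, Submodule.coe_neg, Pi.neg_apply]
      linarith
end
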